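/- Let $\mathcal{O}$ be a valuation ring with fraction field $\mathfrak{C}$, maximal ideal $\mathfrak{m}$, and residue field $k = \mathcal{O}/\mathfrak{m}$ with residue map $\mathrm{res}$. Let $L \subseteq \mathfrak{C}^n$ be a $\mathfrak{C}$-linear subspace and set $L(\mathcal{O}) = L \cap \mathcal{O}^n$. Let $I = \{a \in \mathcal{O}^n : \sum_{i=1}^n a_i x_i = 0 \text{ for all } x \in L\}$. Then $\mathrm{res}(L(\mathcal{O}))$ is exactly the $k$-linear subspace $\{v \in k^n : \sum_{i=1}^n \mathrm{res}(b_i) v_i = 0 \text{ for all } b \in I\}$, and moreover $\dim_k \mathrm{res}(L(\mathcal{O})) = \dim_{\mathfrak{C}} L$. -/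

import Mathlib

/-- A finite torsion-free module over a valuation ring is free. -/
theorem ValuationRing.free_of_finite_of_isTorsionFree (R M : Type*) [CommRing R] [IsDomain R]
    [ValuationRing R] [AddCommGroup M] [Module R M] [Module.Finite R M]
    [Module.IsTorsionFree R M] : Module.Free R M := by
  have : Module.Flat R M := by
    rw [Module.Flat.flat_iff_torsion_eq_bot_of_isBezout,
      ← Submodule.isTorsionFree_iff_torsion_eq_bot]
    infer_instance
  exact Module.free_of_flat_of_isLocalRing

/-- A saturated submodule of a finite module over a valuation ring is a direct summand. -/
theorem ValuationRing.exists_projection_of_saturated {R M : Type*} [CommRing R] [IsDomain R]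
    [ValuationRing R] [AddCommGroup M] [Module R M] [Module.Finite R M] (N : Submodule R M)
    (hN : ∀ (r : R) (x : M), r ≠ 0 → r • x ∈ N → x ∈ N) :
    ∃ p : M →ₗ[R] N, ∀ x : N, p x = x := by
  have : Module.IsTorsionFree R (M ⧸ N) := by
    refine Module.IsTorsionFree.of_smul_eq_zero fun r y h => ?_
    obtain ⟨x, rfl⟩ := N.mkQ_surjective y
    rw [← map_smul, Submodule.mkQ_apply, Submodule.Quotient.mk_eq_zero] at h
    rw [Submodule.mkQ_apply, Submodule.Quotient.mk_eq_zero]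
    exact or_iff_not_imp_left.2 fun hr => hN r x hr h
  have := ValuationRing.free_of_finite_of_isTorsionFree R (M ⧸ N)
  obtain ⟨s, hs⟩ := Module.projective_lifting_property N.mkQ LinearMap.id N.mkQ_surjective
  refine ⟨(LinearMap.id - s ∘ₗ N.mkQ).codRestrict N fun x => ?_, fun x => ?_⟩
  · ext
    simp [(Submodule.Quotient.mk_eq_zero N).2 x.2]
  · have h : N.mkQ (s (N.mkQ x)) = N.mkQ x := LinearMap.congr_fun hs (N.mkQ x)
    have hx : ((LinearMap.id : M →ₗ[R] M) - s ∘ₗ N.mkQ) x ∈ LinearMap.ker N.mkQ := by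
      rw [LinearMap.mem_ker, LinearMap.sub_apply, LinearMap.id_apply, LinearMap.comp_apply,
        map_sub, h, sub_self]
    rwa [N.ker_mkQ] at hx

/-- The residue of a linear form is the linear form with the residues as coefficients. -/
theorem IsLocalRing.residue_linearMap_apply {R : Type*} [CommRing R] [IsLocalRing R] {n : ℕ}
    (f : (Fin n → R) →ₗ[R] R) (x : Fin n → R) :
    IsLocalRing.residue R (f x) =
      ∑ i, IsLocalRing.residue R (f (Pi.single i 1)) * IsLocalRing.residue R (x i) := by
  rw [f.pi_apply_eq_sum_univ x, map_sum]
  refine Finset.sum_congr rfl fun i _ => ?_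
  rw [smul_eq_mul, map_mul, mul_comm]
  congr 4
  ext j
  simp [Pi.single_apply, eq_comm]

/-- The integral points of a linear subspace. -/
def Submodule.integralPoints (O : Type*) {C : Type*} [CommRing O] [Field C] [Algebra O C] {n : ℕ}
    (L : Submodule C (Fin n → C)) : Submodule O (Fin n → O) :=
  (L.restrictScalars O).comap ((Algebra.linearMap O C).compLeft (Fin n))

section IntegralPoints

variable {O C : Type*} [CommRing O] [Field C] [Algebra O C] {n : ℕ} (L : Submodule C (Fin n → C))

theorem Submodule.mem_integralPoints {x : Fin n → O} :
    x ∈ L.integralPoints O ↔ (fun i => algebraMap O C (x i)) ∈ L :=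
  Iff.rfl

variable [IsFractionRing O C]

theorem Submodule.mem_integralPoints_of_smul_mem (r : O) (x : Fin n → O) (hr : r ≠ 0)
    (h : r • x ∈ L.integralPoints O) : x ∈ L.integralPoints O := by
  rw [Submodule.mem_integralPoints] at h ⊢
  have hr' : algebraMap O C r ≠ 0 := by simpa using hr
  rw [← L.smul_mem_iff hr']
  convert h using 1
  ext i
  simp

variable [IsDomain O]

/-- Every vector of `L` becomes an integral point after clearing denominators. -/
theorem Submodule.exists_smul_eq_integralPoint {x : Fin n → C} (hx : x ∈ L) :
    ∃ r : O, r ≠ 0 ∧ ∃ y ∈ L.integralPoints O,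
      (fun i => algebraMap O C (y i)) = algebraMap O C r • x := by
  obtain ⟨r, hr⟩ := IsLocalization.exist_integer_multiples_of_finite (nonZeroDivisors O) x
  choose y hy using hr
  have hxy : (fun i => algebraMap O C (y i)) = algebraMap O C r • x := by
    ext i
    simp [hy, Algebra.smul_def]
  refine ⟨r, nonZeroDivisors.ne_zero r.2, y, ?_, hxy⟩
  rw [Submodule.mem_integralPoints, hxy]
  exact L.smul_mem _ hx

/-- An integral linear form vanishing on the integral points of `L` vanishes on `L`. -/
theorem Submodule.sum_mul_eq_zero_of_integralPoints {b : Fin n → O}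
    (hb : ∀ y ∈ L.integralPoints O, ∑ i, b i * y i = 0) {x : Fin n → C} (hx : x ∈ L) :
    ∑ i, algebraMap O C (b i) * x i = 0 := by
  obtain ⟨r, hr, y, hy, hxy⟩ := L.exists_smul_eq_integralPoint (O := O) hx
  have hr' : algebraMap O C r ≠ 0 := by simpa using hr
  refine (mul_eq_zero.1 ?_).resolve_left hr'
  rw [Finset.mul_sum, ← map_zero (algebraMap O C), ← hb y hy, map_sum]
  refine Finset.sum_congr rfl fun i _ => ?_
  rw [map_mul, congrFun hxy i, Pi.smul_apply, smul_eq_mul]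
  ring

/-- A basis of the integral points of `L` spans a space of dimension `dim L`. -/
theorem Submodule.finrank_eq_card_basis_integralPoints {ι : Type*} [Fintype ι]
    (b : Module.Basis ι O (L.integralPoints O)) : Module.finrank C L = Fintype.card ι := by
  let w : ι → Fin n → C := fun j i => algebraMap O C ((b j : Fin n → O) i)
  have hw : LinearIndependent C w := by
    rw [← LinearIndependent.iff_fractionRing O C]
    have hinj : Function.Injective
        ((Algebra.linearMap O C).compLeft (Fin n) ∘ₗ (L.integralPoints O).subtype) := by
      intro x y h
      ext i
      exact IsFractionRing.injective O C (congrFun h i)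
    exact b.linearIndependent.map' _ (LinearMap.ker_eq_bot.2 hinj)
  have hspan : Submodule.span C (Set.range w) = L := by
    refine le_antisymm (Submodule.span_le.2 ?_) fun x hx => ?_
    · rintro _ ⟨j, rfl⟩
      exact (b j).2
    · obtain ⟨r, hr, y, hy, hxy⟩ := L.exists_smul_eq_integralPoint (O := O) hx
      have hr' : algebraMap O C r ≠ 0 := by simpa using hr
      rw [← Submodule.smul_mem_iff _ hr', ← hxy]
      have hsum : (fun i => algebraMap O C (y i)) =
          ∑ j, algebraMap O C (b.repr ⟨y, hy⟩ j) • w j := by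
        ext i
        have h : y = ∑ j, b.repr ⟨y, hy⟩ j • (b j : Fin n → O) := by
          simpa only [Submodule.coe_sum, Submodule.coe_smul] using
            (congrArg Subtype.val (b.sum_repr ⟨y, hy⟩)).symm
        have h' := congrArg (algebraMap O C) (congrFun h i)
        simpa only [w, Finset.sum_apply, Pi.smul_apply, smul_eq_mul, map_sum, map_mul] using h'
      rw [hsum]
      exact Submodule.sum_mem _ fun j _ =>
        Submodule.smul_mem _ _ (Submodule.subset_span ⟨j, rfl⟩)
  rw [← finrank_span_eq_card hw, hspan]

end IntegralPoints

/-- The residues of a basis of a direct summand of `R ^ n` are a basis of its residue image. -/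
theorem IsLocalRing.finrank_span_residue_image {R : Type*} [CommRing R] [IsLocalRing R] {n : ℕ}
    {N : Submodule R (Fin n → R)} (p : (Fin n → R) →ₗ[R] N) (hp : ∀ x : N, p x = x)
    {ι : Type*} [Fintype ι] (b : Module.Basis ι R N) :
    Module.finrank (IsLocalRing.ResidueField R) (Submodule.span (IsLocalRing.ResidueField R)
      ((fun x : Fin n → R => fun i => IsLocalRing.residue R (x i)) '' (N : Set (Fin n → R))))
      = Fintype.card ι := by
  let w : ι → Fin n → IsLocalRing.ResidueField R :=
    fun j i => IsLocalRing.residue R ((b j : Fin n → R) i)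
  have hsum (c : ι → R) (i : Fin n) : IsLocalRing.residue R
      (((∑ j, c j • b j : N) : Fin n → R) i) =
      (∑ j, IsLocalRing.residue R (c j) • w j) i := by
    simp [w, Finset.sum_apply]
  have hw : LinearIndependent (IsLocalRing.ResidueField R) w := by
    rw [Fintype.linearIndependent_iff]
    intro g hg j
    choose c hc using fun j => IsLocalRing.residue_surjective (g j)
    have h := IsLocalRing.residue_linearMap_apply (b.coord j ∘ₗ p) (∑ j, c j • b j : N)
    simp only [hsum, hc, hg, Pi.zero_apply, mul_zero, Finset.sum_const_zero] at h
    rw [LinearMap.comp_apply, hp, b.coord_apply, b.repr_sum_self, hc] at h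
    exact h
  have hspan : Submodule.span (IsLocalRing.ResidueField R)
      ((fun x : Fin n → R => fun i => IsLocalRing.residue R (x i)) '' (N : Set (Fin n → R)))
      = Submodule.span (IsLocalRing.ResidueField R) (Set.range w) := by
    refine le_antisymm (Submodule.span_le.2 ?_) (Submodule.span_mono ?_)
    · rintro _ ⟨x, hx, rfl⟩
      have h : (fun i => IsLocalRing.residue R (x i)) =
          ∑ j, IsLocalRing.residue R (b.repr ⟨x, hx⟩ j) • w j := by
        ext i
        rw [← hsum, b.sum_repr]
      rw [SetLike.mem_coe]
      change (fun i => IsLocalRing.residue R (x i)) ∈ _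
      rw [h]
      exact Submodule.sum_mem _ fun j _ =>
        Submodule.smul_mem _ _ (Submodule.subset_span ⟨j, rfl⟩)
    · rintro _ ⟨j, rfl⟩
      exact ⟨b j, (b j).2, rfl⟩
  rw [hspan, finrank_span_eq_card hw]

/-- Let `𝒪` be a valuation ring with fraction field `𝔠` and residue field
`k`. For a `𝔠`-linear subspace `L ⊆ 𝔠^n`, the image under the residue map of
`L(𝒪) = L ∩ 𝒪^n` is exactly the `k`-subspace cut out by the residues of the `𝒪`-integral
linear forms vanishing on `L`, and its dimension over `k` equals `dim_𝔠 L`. -/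
theorem stmt11 {O C : Type*} [CommRing O] [IsDomain O] [ValuationRing O]
    [Field C] [Algebra O C] [IsFractionRing O C] (n : ℕ)
    (L : Submodule C (Fin n → C)) :
    (fun x : Fin n → O => fun i => IsLocalRing.residue O (x i)) ''
        {x : Fin n → O | (fun i => algebraMap O C (x i)) ∈ L}
      = {v : Fin n → IsLocalRing.ResidueField O |
          ∀ b : Fin n → O, (∀ x ∈ L, ∑ i, algebraMap O C (b i) * x i = 0) →
            ∑ i, IsLocalRing.residue O (b i) * v i = 0}
    ∧ Module.finrank (IsLocalRing.ResidueField O)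
        (Submodule.span (IsLocalRing.ResidueField O)
          ((fun x : Fin n → O => fun i => IsLocalRing.residue O (x i)) ''
            {x : Fin n → O | (fun i => algebraMap O C (x i)) ∈ L}))
      = Module.finrank C L := by
  obtain ⟨p, hp⟩ := ValuationRing.exists_projection_of_saturated (L.integralPoints O)
    L.mem_integralPoints_of_smul_mem
  constructor
  · ext v
    constructor
    · rintro ⟨x, hx, rfl⟩ b hb
      have h : ∑ i, b i * x i = 0 := by
        apply IsFractionRing.injective O C
        simpa using hb _ hx
      simpa using congrArg (IsLocalRing.residue O) h
    · intro hv
      choose x hx using fun i => IsLocalRing.residue_surjective (v i)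
      refine ⟨p x, (p x).2, ?_⟩
      ext i
      let f : (Fin n → O) →ₗ[O] O :=
        LinearMap.proj i ∘ₗ (LinearMap.id - (L.integralPoints O).subtype ∘ₗ p)
      have hf : ∀ y ∈ L.integralPoints O, ∑ j, f (Pi.single j 1) * y j = 0 := by
        intro y hy
        have h0 : f y = 0 := by simp [f, hp ⟨y, hy⟩]
        rw [← h0, f.pi_apply_eq_sum_univ y]
        refine Finset.sum_congr rfl fun j _ => ?_
        rw [smul_eq_mul, mul_comm]
        congr 2
        ext k
        simp [Pi.single_apply, eq_comm]
      have h := hv _ fun y hy => L.sum_mul_eq_zero_of_integralPoints hf hy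
      simp only [← hx] at h
      rw [← IsLocalRing.residue_linearMap_apply] at h
      have h' : IsLocalRing.residue O (x i) - IsLocalRing.residue O ((p x : Fin n → O) i) = 0 := by
        simpa only [f, LinearMap.comp_apply, LinearMap.sub_apply, LinearMap.id_apply,
          LinearMap.proj_apply, Pi.sub_apply, map_sub, Submodule.subtype_apply] using h
      rw [← hx i]
      exact (sub_eq_zero.1 h').symm
  · have : Module.Finite O (L.integralPoints O) :=
      Module.Finite.of_surjective p fun y => ⟨y, hp y⟩
    have := ValuationRing.free_of_finite_of_isTorsionFree O (L.integralPoints O)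
    have b := Module.finBasis O (L.integralPoints O)
    exact (IsLocalRing.finrank_span_residue_image p hp b).trans
      (L.finrank_eq_card_basis_integralPoints b).symm
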